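/- Let f = x² + y³ and g = y in ℚ[x,y]. For every b ∈ ℚ[s], b satisfies the Bernstein–Sato functional equation for the pair (f, g) if and only if (s + 1)(s + 7/6)(s + 11/6) divides b in ℚ[s]; that is, b_{f,y}(s) = (s + 1)(s + 7/6)(s + 11/6). -/

import Mathlib

open MvPolynomial Polynomial

/-- The iterated formal partial derivative `∂^α = ∏ᵢ ∂_{xᵢ}^{αᵢ}` applied to a
multivariate polynomial (the partial derivatives pairwise commute, so the order
of the fold is immaterial). -/
noncomputable def pdIter {σ : Type*} [Fintype σ] (α : σ → ℕ)
    (p : MvPolynomial σ ℚ) : MvPolynomial σ ℚ :=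
  Finset.univ.toList.foldl (fun q i => (⇑(MvPolynomial.pderiv i))^[α i] q) p

/-- `b ∈ ℚ[s]` satisfies the Bernstein–Sato functional equation for the pair
`(f, g)`: there are finitely many multi-indices `α` and polynomials
`p_α ∈ (ℚ[x])[s]` with `b(m)·g·f^m = Σ_α p_α(m)·∂^α(g·f^(m+1))` for all `m ∈ ℕ`. -/
def SatisfiesBS {σ : Type*} [Fintype σ] (f g : MvPolynomial σ ℚ)
    (b : Polynomial ℚ) : Prop :=
  ∃ (A : Finset (σ → ℕ)) (p : (σ → ℕ) → Polynomial (MvPolynomial σ ℚ)),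
    ∀ m : ℕ,
      MvPolynomial.C (Polynomial.eval (m : ℚ) b) * g * f ^ m =
        ∑ α ∈ A, Polynomial.eval ((m : ℕ) : MvPolynomial σ ℚ) (p α) *
          pdIter α (g * f ^ (m + 1))

/-- Applying `∂^α` in two variables, with a fixed order of the partial derivatives. -/
theorem pdIter_fin_two (α : Fin 2 → ℕ) (p : MvPolynomial (Fin 2) ℚ) :
    pdIter α p = (⇑(pderiv (0 : Fin 2)))^[α 0] ((⇑(pderiv (1 : Fin 2)))^[α 1] p) := by
  have hcomm : ∀ i j : Fin 2, Function.Commute (⇑(pderiv (R := ℚ) i)) (⇑(pderiv (R := ℚ) j)) := by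
    intro i j q
    have h : ⁅pderiv (R := ℚ) i, pderiv (R := ℚ) j⁆ = 0 :=
      MvPolynomial.derivation_ext fun k => by
        classical
        rw [Derivation.commutator_apply, pderiv_X, pderiv_X, Pi.single_apply, Pi.single_apply]
        split_ifs <;> simp
    have h' := DFunLike.congr_fun h q
    rw [Derivation.commutator_apply] at h'
    exact sub_eq_zero.mp h'
  have hperm : (Finset.univ : Finset (Fin 2)).toList.Perm [1, 0] := by
    rw [← Multiset.coe_eq_coe, Finset.coe_toList]
    decide
  rw [pdIter, hperm.foldl_eq' fun x _ y _ z =>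
    ((hcomm y x).iterate_iterate (α y) (α x)).eq z]
  rfl

local notation "cusp" => (MvPolynomial.X 0 ^ 2 + MvPolynomial.X 1 ^ 3 : MvPolynomial (Fin 2) ℚ)

theorem pderiv_zero_cusp_pow (n : ℕ) :
    pderiv 0 (cusp ^ (n + 1)) =
      2 * ((n : MvPolynomial (Fin 2) ℚ) + 1) * MvPolynomial.X 0 * cusp ^ n := by
  rw [pderiv_pow, map_add, pderiv_pow, pderiv_pow, pderiv_X_self, pderiv_X_of_ne (by decide)]
  push_cast
  ring

theorem pderiv_one_cusp_pow (n : ℕ) :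
    pderiv 1 (cusp ^ (n + 1)) =
      3 * ((n : MvPolynomial (Fin 2) ℚ) + 1) * MvPolynomial.X 1 ^ 2 * cusp ^ n := by
  rw [pderiv_pow, map_add, pderiv_pow, pderiv_pow, pderiv_X_self, pderiv_X_of_ne (by decide)]
  push_cast
  ring

theorem cusp_operator (m : ℕ) :
    8 * pderiv 1 (pderiv 1 (pderiv 1 (MvPolynomial.X 1 * cusp ^ (m + 1)))) +
      18 * MvPolynomial.X 1 * pderiv 0 (pderiv 0 (pderiv 1 (MvPolynomial.X 1 * cusp ^ (m + 1)))) +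
      (54 * (m : MvPolynomial (Fin 2) ℚ) + 117) *
        pderiv 0 (pderiv 0 (MvPolynomial.X 1 * cusp ^ (m + 1))) =
    6 * ((m : MvPolynomial (Fin 2) ℚ) + 1) * (6 * (m : MvPolynomial (Fin 2) ℚ) + 7) *
      (6 * (m : MvPolynomial (Fin 2) ℚ) + 11) *
      (MvPolynomial.X 1 * cusp ^ m) := by
  have hn : ∀ (i : Fin 2) (n : ℕ), pderiv i (n : MvPolynomial (Fin 2) ℚ) = 0 := fun i n =>
    (pderiv i).map_natCast n
  have hk : ∀ (i : Fin 2) (n : ℕ) [n.AtLeastTwo],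
      pderiv i (OfNat.ofNat n : MvPolynomial (Fin 2) ℚ) = 0 := fun i n _ => hn i n
  have h01 : pderiv (0 : Fin 2) (MvPolynomial.X 1 : MvPolynomial (Fin 2) ℚ) = 0 :=
    pderiv_X_of_ne (by decide)
  have hsq : ∀ i j : Fin 2, pderiv i (MvPolynomial.X j ^ 2 : MvPolynomial (Fin 2) ℚ) =
      2 * MvPolynomial.X j * pderiv i (MvPolynomial.X j) := fun i j => by
    rw [sq, pderiv_mul]; ring
  rcases m with _ | _ | m <;>
  simp only [pderiv_zero_cusp_pow, pderiv_one_cusp_pow, pderiv_mul, pderiv_one, hn, hk, h01,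
    pderiv_X_self, hsq, map_add, map_zero, pow_zero] <;>
  push_cast <;>
  ring

theorem bernsteinSato_divisor_satisfies (c : Polynomial ℚ) :
    SatisfiesBS ((MvPolynomial.X 0) ^ 2 + (MvPolynomial.X 1) ^ 3 : MvPolynomial (Fin 2) ℚ)
      (MvPolynomial.X 1)
      ((Polynomial.X + Polynomial.C (1 : ℚ)) *
            (Polynomial.X + Polynomial.C (7 / 6 : ℚ)) *
            (Polynomial.X + Polynomial.C (11 / 6 : ℚ)) * c) := by
  let r : Polynomial ℚ → Polynomial (MvPolynomial (Fin 2) ℚ) := Polynomial.map MvPolynomial.C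
  let t : (Fin 2 → ℕ) → Polynomial (MvPolynomial (Fin 2) ℚ) := fun α =>
    if α = ![0, 3] then 8
    else if α = ![2, 1] then 18 * Polynomial.C (MvPolynomial.X 1)
    else 54 * Polynomial.X + 117
  refine ⟨{![0, 3], ![2, 1], ![2, 0]}, fun α => r (Polynomial.C (1 / 216) * c) * t α,
    fun m => ?_⟩
  have h1 : (![0, 3] : Fin 2 → ℕ) ≠ ![2, 1] := by decide
  have h2 : (![0, 3] : Fin 2 → ℕ) ≠ ![2, 0] := by decide
  have h3 : (![2, 1] : Fin 2 → ℕ) ≠ ![2, 0] := by decide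
  have hr : ∀ q : Polynomial ℚ, Polynomial.eval (m : MvPolynomial (Fin 2) ℚ) (r q) =
      MvPolynomial.C (Polynomial.eval (m : ℚ) q) := fun q =>
    Polynomial.eval_natCast_map MvPolynomial.C q m
  have hb : ((m : ℚ) + 1) * (m + 7 / 6) * (m + 11 / 6) * Polynomial.eval (m : ℚ) c =
      6 * (m + 1) * (6 * m + 7) * (6 * m + 11) * (1 / 216 * Polynomial.eval (m : ℚ) c) := by
    ring
  rw [Finset.sum_insert (by simp [h1, h2]), Finset.sum_insert (by simp [h3]),
    Finset.sum_singleton]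
  simp only [t, if_neg h1.symm, if_neg h2.symm, if_neg h3.symm, if_true, Polynomial.eval_mul, hr,
    Polynomial.eval_C, Polynomial.eval_add, Polynomial.eval_X, pdIter_fin_two, hb,
    Polynomial.eval_ofNat]
  simp only [Matrix.cons_val_zero, Matrix.cons_val_one, Function.iterate_succ_apply,
    Function.iterate_zero_apply, map_mul, map_add, map_ofNat, map_natCast, map_one]
  linear_combination -(MvPolynomial.C (1 / 216 : ℚ) * MvPolynomial.C (Polynomial.eval (m : ℚ) c)) *
    cusp_operator m

/-- Values at `x ^ n` of a functional on `ℚ[x]` behaving like `∫ (·) exp (-x²)`. -/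
noncomputable def momentX : ℕ → ℚ
  | 0 => 1
  | 1 => 0
  | n + 2 => (n + 1) / 2 * momentX n

/-- Values at `y ^ n` of a functional on `ℚ[y]` behaving like `∫ (·) exp (-y³)` over a
contour, with prescribed values at `1` and `y`. -/
noncomputable def momentY (a b : ℚ) : ℕ → ℚ
  | 0 => a
  | 1 => b
  | 2 => 0
  | n + 3 => (n + 1) / 3 * momentY a b n

/-- A functional on `ℚ[x, y]` behaving like `∫ (·) exp (-(x² + y³))`. -/
noncomputable def moment (a b : ℚ) : MvPolynomial (Fin 2) ℚ →ₗ[ℚ] ℚ :=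
  (MvPolynomial.basisMonomials (Fin 2) ℚ).constr ℚ fun d => momentX (d 0) * momentY a b (d 1)

theorem moment_monomial (a b : ℚ) (d : Fin 2 →₀ ℕ) (c : ℚ) :
    moment a b (monomial d c) = c * (momentX (d 0) * momentY a b (d 1)) := by
  have h : monomial d c = c • (MvPolynomial.basisMonomials (Fin 2) ℚ) d := by
    simp [MvPolynomial.smul_monomial]
  rw [h, map_smul, moment, Module.Basis.constr_basis, smul_eq_mul]

theorem moment_pderiv_zero (a b : ℚ) (h : MvPolynomial (Fin 2) ℚ) :
    moment a b (pderiv 0 h) = 2 * moment a b (MvPolynomial.X 0 * h) := by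
  induction h using MvPolynomial.induction_on' with
  | add p q hp hq => simp only [map_add, mul_add, hp, hq]
  | monomial d c =>
    rw [pderiv_monomial, MvPolynomial.X, monomial_mul, moment_monomial, moment_monomial]
    simp only [Finsupp.coe_add, Finsupp.coe_tsub, Pi.add_apply, Pi.sub_apply,
      Finsupp.single_eq_same, ne_eq, one_ne_zero, not_false_eq_true, Finsupp.single_eq_of_ne,
      zero_add, Nat.sub_zero, one_mul]
    rcases d 0 with _ | n
    · simp [momentX]
    · rw [add_comm 1, Nat.add_sub_cancel, momentX]
      push_cast
      ring

theorem moment_pderiv_one (a b : ℚ) (h : MvPolynomial (Fin 2) ℚ) :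
    moment a b (pderiv 1 h) = 3 * moment a b (MvPolynomial.X 1 ^ 2 * h) := by
  induction h using MvPolynomial.induction_on' with
  | add p q hp hq => simp only [map_add, mul_add, hp, hq]
  | monomial d c =>
    rw [pderiv_monomial, MvPolynomial.X_pow_eq_monomial, monomial_mul, moment_monomial, moment_monomial]
    simp only [Finsupp.coe_add, Finsupp.coe_tsub, Pi.add_apply, Pi.sub_apply,
      Finsupp.single_eq_same, ne_eq, zero_ne_one, not_false_eq_true, Finsupp.single_eq_of_ne,
      zero_add, Nat.sub_zero, one_mul]
    rcases d 1 with _ | n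
    · simp [momentY]
    · rw [show 2 + (n + 1) = n + 3 by ring, Nat.add_sub_cancel, momentY]
      push_cast
      ring

theorem moment_cusp_mul (a b : ℚ) (h : MvPolynomial (Fin 2) ℚ) :
    moment a b (cusp * h) = 5 / 6 * moment a b h +
      1 / 2 * moment a b (MvPolynomial.X 0 * pderiv 0 h) +
      1 / 3 * moment a b (MvPolynomial.X 1 * pderiv 1 h) := by
  have h0 := moment_pderiv_zero a b (MvPolynomial.X 0 * h)
  have h1 := moment_pderiv_one a b (MvPolynomial.X 1 * h)
  rw [pderiv_mul, pderiv_X_self, one_mul, map_add, ← mul_assoc] at h0 h1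
  rw [add_mul, map_add, sq, pow_succ]
  linarith

theorem monomial_euler (d : Fin 2 →₀ ℕ) (c : ℚ) (i : Fin 2) :
    MvPolynomial.X i * pderiv i (monomial d c) = MvPolynomial.C (d i : ℚ) * monomial d c := by
  rw [pderiv_monomial, MvPolynomial.X, monomial_mul, MvPolynomial.C_mul_monomial]
  rcases h : d i with _ | n
  · simp
  · rw [add_tsub_cancel_of_le (Finsupp.single_le_iff.mpr (by omega))]
    congr 1
    push_cast
    ring

theorem cusp_pow_euler (m : ℕ) :
    3 * (MvPolynomial.X 0 * pderiv 0 (cusp ^ m)) + 2 * (MvPolynomial.X 1 * pderiv 1 (cusp ^ m)) =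
      MvPolynomial.C (6 * m : ℚ) * cusp ^ m := by
  rcases m with _ | m
  · simp
  · rw [pderiv_zero_cusp_pow, pderiv_one_cusp_pow]
    simp only [map_mul, map_ofNat, map_natCast]
    push_cast
    ring

theorem moment_C_mul (a b c : ℚ) (h : MvPolynomial (Fin 2) ℚ) :
    moment a b (MvPolynomial.C c * h) = c * moment a b h := by
  rw [MvPolynomial.C_mul', map_smul, smul_eq_mul]

theorem moment_monomial_mul_cusp_pow (a b : ℚ) (d : Fin 2 →₀ ℕ) (c : ℚ) (m : ℕ) :
    moment a b (monomial d c * cusp ^ m) =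
      (ascPochhammer ℚ m).eval (5 / 6 + (d 0 : ℚ) / 2 + (d 1 : ℚ) / 3) *
        moment a b (monomial d c) := by
  induction m with
  | zero => simp
  | succ m ih =>
    have hE := congrArg (moment a b) (congrArg (monomial d c * ·) (cusp_pow_euler m))
    have hx : ∀ i : Fin 2, moment a b (MvPolynomial.X i * pderiv i (monomial d c * cusp ^ m)) =
        d i * moment a b (monomial d c * cusp ^ m) +
          moment a b (monomial d c * (MvPolynomial.X i * pderiv i (cusp ^ m))) := fun i => by
      rw [← moment_C_mul, ← map_add, pderiv_mul, ← mul_assoc, ← monomial_euler]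
      ring_nf
    have h3 : (3 : MvPolynomial (Fin 2) ℚ) = MvPolynomial.C 3 := (map_ofNat _ 3).symm
    have h2 : (2 : MvPolynomial (Fin 2) ℚ) = MvPolynomial.C 2 := (map_ofNat _ 2).symm
    rw [mul_add, map_add, mul_left_comm, mul_left_comm _ 2, mul_left_comm _ (MvPolynomial.C _),
      h3, h2, moment_C_mul, moment_C_mul, moment_C_mul] at hE
    rw [pow_succ', mul_left_comm, moment_cusp_mul, hx, hx, ascPochhammer_succ_eval]
    linear_combination (5 / 6 + (d 0 : ℚ) / 2 + (d 1 : ℚ) / 3 + m) * ih + hE / 6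

theorem exists_ascPochhammer_eval_add (l : ℚ) (hl : 0 < l) (n : ℕ) :
    ∃ q : Polynomial ℚ, ∀ m : ℕ, (ascPochhammer ℚ m).eval (l + n) =
      (ascPochhammer ℚ m).eval l * q.eval (m : ℚ) := by
  induction n with
  | zero => exact ⟨1, by simp⟩
  | succ n ih =>
    obtain ⟨q, hq⟩ := ih
    refine ⟨q * (Polynomial.C (l + n)⁻¹ * (Polynomial.X + Polynomial.C (l + n))), fun m => ?_⟩
    have h : (l + n) * (ascPochhammer ℚ m).eval (l + n + 1) =
        (ascPochhammer ℚ m).eval (l + n) * (l + n + m) := by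
      rw [← ascPochhammer_succ_eval, ascPochhammer_succ_left]
      simp
    have hne : l + n ≠ 0 := by positivity
    simp only [Polynomial.eval_mul, Polynomial.eval_C, Polynomial.eval_add, Polynomial.eval_X]
    rw [← mul_assoc, ← hq, Nat.cast_succ, ← add_assoc]
    field_simp
    linear_combination h

theorem exists_moment_X_mul_cusp_pow (a b l : ℚ) (hl : 0 < l)
    (hw : ∀ i j : ℕ, momentX i * momentY a b (j + 1) ≠ 0 →
      ∃ n : ℕ, 5 / 6 + (i : ℚ) / 2 + (j + 1 : ℕ) / 3 = l + n)
    (p : MvPolynomial (Fin 2) ℚ) :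
    ∃ q : Polynomial ℚ, ∀ m : ℕ, moment a b (p * MvPolynomial.X 1 * cusp ^ m) =
      (ascPochhammer ℚ m).eval l * q.eval (m : ℚ) := by
  induction p using MvPolynomial.induction_on' with
  | add p p' hp hp' =>
    obtain ⟨q, hq⟩ := hp
    obtain ⟨q', hq'⟩ := hp'
    exact ⟨q + q', fun m => by rw [add_mul, add_mul, map_add, hq, hq', Polynomial.eval_add]; ring⟩
  | monomial d c =>
    have hX : MvPolynomial.monomial d c * MvPolynomial.X 1 =
        MvPolynomial.monomial (d + Finsupp.single 1 1) c := by
      rw [MvPolynomial.X, monomial_mul, mul_one]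
    have h0 : (d + Finsupp.single (1 : Fin 2) 1 : Fin 2 →₀ ℕ) 0 = d 0 := by simp
    have h1 : (d + Finsupp.single (1 : Fin 2) 1 : Fin 2 →₀ ℕ) 1 = d 1 + 1 := by simp
    simp only [hX, moment_monomial_mul_cusp_pow, moment_monomial, h0, h1]
    by_cases h : momentX (d 0) * momentY a b (d 1 + 1) = 0
    · exact ⟨0, fun m => by simp [h]⟩
    · obtain ⟨n, hn⟩ := hw _ _ h
      obtain ⟨q, hq⟩ := exists_ascPochhammer_eval_add l hl n
      refine ⟨q * Polynomial.C (c * (momentX (d 0) * momentY a b (d 1 + 1))), fun m => ?_⟩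
      rw [hn, hq, Polynomial.eval_mul, Polynomial.eval_C, mul_assoc]

theorem exists_moment_mul_pderiv (a b : ℚ) (i : Fin 2) (r : MvPolynomial (Fin 2) ℚ) :
    ∃ r' : MvPolynomial (Fin 2) ℚ, ∀ h, moment a b (r * pderiv i h) = moment a b (r' * h) := by
  fin_cases i
  · refine ⟨MvPolynomial.C 2 * (MvPolynomial.X 0 * r) - pderiv 0 r, fun h => ?_⟩
    have := moment_pderiv_zero a b (r * h)
    rw [pderiv_mul, map_add] at this
    rw [sub_mul, map_sub, mul_assoc, moment_C_mul, mul_assoc]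
    exact eq_sub_of_add_eq' this
  · refine ⟨MvPolynomial.C 3 * (MvPolynomial.X 1 ^ 2 * r) - pderiv 1 r, fun h => ?_⟩
    have := moment_pderiv_one a b (r * h)
    rw [pderiv_mul, map_add] at this
    rw [sub_mul, map_sub, mul_assoc, moment_C_mul, mul_assoc]
    exact eq_sub_of_add_eq' this

theorem exists_moment_mul_pdIter (a b : ℚ) (α : Fin 2 → ℕ) (r : MvPolynomial (Fin 2) ℚ) :
    ∃ r' : MvPolynomial (Fin 2) ℚ, ∀ h, moment a b (r * pdIter α h) = moment a b (r' * h) := by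
  have hiter : ∀ (i : Fin 2) (k : ℕ) (r : MvPolynomial (Fin 2) ℚ),
      ∃ r' : MvPolynomial (Fin 2) ℚ, ∀ h,
        moment a b (r * (⇑(pderiv i))^[k] h) = moment a b (r' * h) := by
    intro i k
    induction k with
    | zero => exact fun r => ⟨r, fun h => rfl⟩
    | succ k ih =>
      intro r
      obtain ⟨r₁, h₁⟩ := ih r
      obtain ⟨r₂, h₂⟩ := exists_moment_mul_pderiv a b i r₁
      exact ⟨r₂, fun h => by rw [Function.iterate_succ_apply, h₁, h₂]⟩
  obtain ⟨r₁, h₁⟩ := hiter 0 (α 0) r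
  obtain ⟨r₂, h₂⟩ := hiter 1 (α 1) r₁
  exact ⟨r₂, fun h => by rw [pdIter_fin_two, h₁, h₂]⟩

theorem polynomial_eq_of_eval_natCast {R : Type*} [CommRing R] [IsDomain R] [CharZero R]
    {p q : Polynomial R} (h : ∀ m : ℕ, p.eval (m : R) = q.eval (m : R)) : p = q :=
  Polynomial.eq_of_infinite_eval_eq p q
    ((Set.infinite_range_of_injective Nat.cast_injective).mono (Set.range_subset_iff.mpr h))

/-- Moments of differential operators applied to `y f^(m+1)` are polynomial in `m`, up to the
factor `(l)_(m+1)`. -/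
theorem exists_moment_operator (a b l : ℚ) (hl : 0 < l)
    (hw : ∀ i j : ℕ, momentX i * momentY a b (j + 1) ≠ 0 →
      ∃ n : ℕ, 5 / 6 + (i : ℚ) / 2 + (j + 1 : ℕ) / 3 = l + n)
    (t : MvPolynomial (Fin 2) ℚ) (α : Fin 2 → ℕ) (p : Polynomial (MvPolynomial (Fin 2) ℚ)) :
    ∃ q : Polynomial ℚ, ∀ m : ℕ,
      moment a b (t * (p.eval (m : MvPolynomial (Fin 2) ℚ) *
        pdIter α (MvPolynomial.X 1 * cusp ^ (m + 1)))) =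
      (ascPochhammer ℚ (m + 1)).eval l * q.eval (m : ℚ) := by
  induction p using Polynomial.induction_on' with
  | add p p' hp hp' =>
    obtain ⟨q, hq⟩ := hp
    obtain ⟨q', hq'⟩ := hp'
    exact ⟨q + q', fun m => by
      rw [Polynomial.eval_add, Polynomial.eval_add, add_mul, mul_add, map_add, hq, hq']; ring⟩
  | monomial k r =>
    obtain ⟨r', hr'⟩ := exists_moment_mul_pdIter a b α (t * r)
    obtain ⟨q, hq⟩ := exists_moment_X_mul_cusp_pow a b l hl hw r'
    refine ⟨Polynomial.X ^ k * q.comp (Polynomial.X + 1), fun m => ?_⟩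
    have hm : ((m : MvPolynomial (Fin 2) ℚ)) ^ k = MvPolynomial.C ((m : ℚ) ^ k) := by simp
    rw [Polynomial.eval_monomial, hm, mul_comm r, mul_assoc, mul_left_comm, moment_C_mul,
      ← mul_assoc t, hr', ← mul_assoc r', hq]
    simp
    ring

theorem X_add_C_dvd_of_satisfiesBS (a b l : ℚ) (hl : 0 < l)
    (hw : ∀ i j : ℕ, momentX i * momentY a b (j + 1) ≠ 0 →
      ∃ n : ℕ, 5 / 6 + (i : ℚ) / 2 + (j + 1 : ℕ) / 3 = l + n)
    (k : ℕ) (hk : 5 / 6 + ((k + 1 : ℕ) : ℚ) / 3 = l) (hne : momentY a b (k + 1) ≠ 0)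
    {β : Polynomial ℚ} (hβ : SatisfiesBS cusp (MvPolynomial.X 1) β) :
    Polynomial.X + Polynomial.C l ∣ β := by
  obtain ⟨A, p, h⟩ := hβ
  choose q hq using fun α => exists_moment_operator a b l hl hw (MvPolynomial.X 1 ^ k) α (p α)
  have hmon : (MvPolynomial.X 1 ^ k * MvPolynomial.X 1 : MvPolynomial (Fin 2) ℚ) =
      MvPolynomial.monomial (Finsupp.single 1 (k + 1)) 1 := by
    rw [← pow_succ, MvPolynomial.X_pow_eq_monomial]
  have hm0 : moment a b (MvPolynomial.X 1 ^ k * MvPolynomial.X 1) = momentY a b (k + 1) := by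
    rw [hmon, moment_monomial]
    simp [momentX]
  have key : β * Polynomial.C (momentY a b (k + 1)) =
      (Polynomial.X + Polynomial.C l) * ∑ α ∈ A, q α := by
    refine polynomial_eq_of_eval_natCast fun m => ?_
    have hm := congrArg (moment a b) (congrArg (MvPolynomial.X 1 ^ k * ·) (h m))
    rw [Finset.mul_sum, map_sum, Finset.sum_congr rfl fun α _ => hq α m, ← Finset.mul_sum,
      mul_assoc, mul_left_comm, moment_C_mul, ← mul_assoc, hmon,
      moment_monomial_mul_cusp_pow, ← hmon, hm0] at hm
    simp only [Finsupp.single_eq_same, Finsupp.single_eq_of_ne (show (0 : Fin 2) ≠ 1 by decide),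
      Nat.cast_zero, zero_div, add_zero, hk, ascPochhammer_succ_eval] at hm
    have hpos := (ascPochhammer_pos m l hl).ne'
    rw [Polynomial.eval_mul, Polynomial.eval_mul, Polynomial.eval_finsetSum]
    simp only [Polynomial.eval_add, Polynomial.eval_C, Polynomial.eval_X]
    refine mul_left_cancel₀ hpos ?_
    linear_combination hm
  have hu : IsUnit (Polynomial.C (momentY a b (k + 1))) := Polynomial.isUnit_C.mpr hne.isUnit
  exact hu.dvd_mul_right.mp ⟨_, key⟩

theorem momentX_ne_zero : ∀ {i : ℕ}, momentX i ≠ 0 → ∃ n : ℕ, i = 2 * n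
  | 0, _ => ⟨0, rfl⟩
  | 1, h => absurd rfl h
  | i + 2, h => by
    rw [momentX] at h
    obtain ⟨n, rfl⟩ := momentX_ne_zero (right_ne_zero_of_mul h)
    exact ⟨n + 1, rfl⟩

theorem momentY_one_zero_ne_zero : ∀ {j : ℕ}, momentY 1 0 j ≠ 0 → ∃ n : ℕ, j = 3 * n
  | 0, _ => ⟨0, rfl⟩
  | 1, h => absurd rfl h
  | 2, h => absurd rfl h
  | j + 3, h => by
    rw [momentY] at h
    obtain ⟨n, rfl⟩ := momentY_one_zero_ne_zero (right_ne_zero_of_mul h)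
    exact ⟨n + 1, rfl⟩

theorem momentY_zero_one_ne_zero : ∀ {j : ℕ}, momentY 0 1 j ≠ 0 → ∃ n : ℕ, j = 3 * n + 1
  | 0, h => absurd rfl h
  | 1, _ => ⟨0, rfl⟩
  | 2, h => absurd rfl h
  | j + 3, h => by
    rw [momentY] at h
    obtain ⟨n, rfl⟩ := momentY_zero_one_ne_zero (right_ne_zero_of_mul h)
    exact ⟨n + 1, rfl⟩

theorem X_add_seven_sixths_dvd {β : Polynomial ℚ}
    (hβ : SatisfiesBS cusp (MvPolynomial.X 1) β) : Polynomial.X + Polynomial.C (7 / 6) ∣ β := by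
  refine X_add_C_dvd_of_satisfiesBS 0 1 _ (by norm_num) (fun i j h => ?_) 0 (by norm_num)
    (by norm_num [momentY]) hβ
  obtain ⟨n, rfl⟩ := momentX_ne_zero (left_ne_zero_of_mul h)
  obtain ⟨k, hk⟩ := momentY_zero_one_ne_zero (right_ne_zero_of_mul h)
  refine ⟨n + k, ?_⟩
  rw [hk]
  push_cast
  ring

theorem X_add_eleven_sixths_dvd {β : Polynomial ℚ}
    (hβ : SatisfiesBS cusp (MvPolynomial.X 1) β) : Polynomial.X + Polynomial.C (11 / 6) ∣ β := by
  refine X_add_C_dvd_of_satisfiesBS 1 0 _ (by norm_num) (fun i j h => ?_) 2 (by norm_num)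
    (by norm_num [momentY]) hβ
  obtain ⟨n, rfl⟩ := momentX_ne_zero (left_ne_zero_of_mul h)
  obtain ⟨k, hk⟩ := momentY_one_zero_ne_zero (right_ne_zero_of_mul h)
  obtain ⟨k, rfl⟩ := Nat.exists_eq_succ_of_ne_zero (show k ≠ 0 by omega)
  refine ⟨n + k, ?_⟩
  rw [hk]
  push_cast
  ring

/-- The family `u` agrees, after multiplication by a power of `f`, with `Q(m) f^(m+1)`, where
`Q` is divisible by that power of `f` at `s = -1`. -/
def PoleFreeAtNegOne (f : MvPolynomial (Fin 2) ℚ) (u : ℕ → MvPolynomial (Fin 2) ℚ) : Prop :=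
  ∃ (k : ℕ) (Q : Polynomial (MvPolynomial (Fin 2) ℚ)) (D : MvPolynomial (Fin 2) ℚ),
    (∀ m : ℕ, f ^ k * u m = Q.eval (m : MvPolynomial (Fin 2) ℚ) * f ^ (m + 1)) ∧
      Q.eval (-1) = f ^ k * D

namespace PoleFreeAtNegOne

variable {f : MvPolynomial (Fin 2) ℚ} {u v : ℕ → MvPolynomial (Fin 2) ℚ}

theorem zero : PoleFreeAtNegOne f 0 := ⟨0, 0, 0, by simp, by simp⟩

theorem add (hu : PoleFreeAtNegOne f u) (hv : PoleFreeAtNegOne f v) :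
    PoleFreeAtNegOne f (u + v) := by
  obtain ⟨k, Q, D, h, hD⟩ := hu
  obtain ⟨k', Q', D', h', hD'⟩ := hv
  refine ⟨k + k', Polynomial.C (f ^ k') * Q + Polynomial.C (f ^ k) * Q', D + D',
    fun m => ?_, ?_⟩
  · simp only [Polynomial.eval_add, Polynomial.eval_mul, Polynomial.eval_C, Pi.add_apply]
    linear_combination f ^ k' * h m + f ^ k * h' m
  · simp only [Polynomial.eval_add, Polynomial.eval_mul, Polynomial.eval_C, hD, hD']
    ring

theorem eval_mul (hu : PoleFreeAtNegOne f u) (p : Polynomial (MvPolynomial (Fin 2) ℚ)) :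
    PoleFreeAtNegOne f fun m => p.eval (m : MvPolynomial (Fin 2) ℚ) * u m := by
  obtain ⟨k, Q, D, h, hD⟩ := hu
  refine ⟨k, p * Q, p.eval (-1) * D, fun m => ?_, ?_⟩
  · rw [Polynomial.eval_mul]
    linear_combination p.eval (m : MvPolynomial (Fin 2) ℚ) * h m
  · rw [Polynomial.eval_mul, hD]
    ring

theorem exists_pderiv_eval (i : Fin 2) (Q : Polynomial (MvPolynomial (Fin 2) ℚ)) :
    ∃ Q' : Polynomial (MvPolynomial (Fin 2) ℚ), ∀ n : ℤ,
      Q'.eval (n : MvPolynomial (Fin 2) ℚ) = pderiv i (Q.eval (n : MvPolynomial (Fin 2) ℚ)) := by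
  induction Q using Polynomial.induction_on' with
  | add p q hp hq =>
    obtain ⟨p', hp⟩ := hp
    obtain ⟨q', hq⟩ := hq
    exact ⟨p' + q', fun n => by simp [hp, hq]⟩
  | monomial k r =>
    refine ⟨Polynomial.monomial k (pderiv i r), fun n => ?_⟩
    rw [Polynomial.eval_monomial, Polynomial.eval_monomial, pderiv_mul, ← Int.cast_pow,
      (pderiv i).map_intCast, mul_zero, add_zero]

theorem map_pderiv (hu : PoleFreeAtNegOne f u) (i : Fin 2) :
    PoleFreeAtNegOne f fun m => pderiv i (u m) := by
  obtain ⟨k, Q, D, h, hD⟩ := hu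
  obtain ⟨Q', hQ'⟩ := exists_pderiv_eval i Q
  have hpow : ∀ n : ℕ, f * pderiv i (f ^ n) = n * f ^ n * pderiv i f := by
    rintro (_ | n)
    · simp
    · rw [pderiv_pow, Nat.add_sub_cancel]
      ring
  refine ⟨k + 1, Polynomial.C f * Q' +
    (Polynomial.X + 1 - Polynomial.C (k : MvPolynomial (Fin 2) ℚ)) *
      Polynomial.C (pderiv i f) * Q, pderiv i D, fun m => ?_, ?_⟩
  · have hm := congrArg (pderiv i) (h m)
    have hQm := hQ' m
    have hpm := hpow (m + 1)
    rw [Int.cast_natCast] at hQm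
    rw [pderiv_mul, pderiv_mul, ← hQm] at hm
    simp only [Polynomial.eval_add, Polynomial.eval_sub, Polynomial.eval_mul, Polynomial.eval_C,
      Polynomial.eval_X, Polynomial.eval_one]
    push_cast at hpm
    linear_combination f * hm - u m * hpow k - k * pderiv i f * h m +
      Q.eval (m : MvPolynomial (Fin 2) ℚ) * hpm
  · have hQm := hQ' (-1)
    have hd := congrArg (pderiv i) hD
    rw [Int.cast_neg, Int.cast_one] at hQm
    rw [← hQm, pderiv_mul] at hd
    simp only [Polynomial.eval_add, Polynomial.eval_sub, Polynomial.eval_mul, Polynomial.eval_C,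
      Polynomial.eval_X, Polynomial.eval_one, hd, hD]
    linear_combination D * hpow k

theorem map_pderiv_iterate (hu : PoleFreeAtNegOne f u) (i : Fin 2) (n : ℕ) :
    PoleFreeAtNegOne f fun m => (⇑(pderiv i))^[n] (u m) := by
  induction n with
  | zero => exact hu
  | succ n ih => simpa only [Function.iterate_succ_apply'] using ih.map_pderiv i

theorem map_pdIter (hu : PoleFreeAtNegOne f u) (α : Fin 2 → ℕ) :
    PoleFreeAtNegOne f fun m => pdIter α (u m) := by
  simpa only [pdIter_fin_two] using
    (hu.map_pderiv_iterate 1 (α 1)).map_pderiv_iterate 0 (α 0)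

theorem sum {ι : Type*} (A : Finset ι) {w : ι → ℕ → MvPolynomial (Fin 2) ℚ}
    (hw : ∀ α, PoleFreeAtNegOne f (w α)) : PoleFreeAtNegOne f (∑ α ∈ A, w α) :=
  Finset.sum_induction _ _ (fun _ _ => add) zero fun α _ => hw α

end PoleFreeAtNegOne

/-- If `f` does not divide `g`, then `-1` is a root of every Bernstein–Sato relation. -/
theorem X_add_one_dvd_of_satisfiesBS {f g : MvPolynomial (Fin 2) ℚ} (hf : f ≠ 0)
    (hfg : ¬ f ∣ g) {β : Polynomial ℚ} (hβ : SatisfiesBS f g β) :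
    Polynomial.X + Polynomial.C 1 ∣ β := by
  obtain ⟨A, p, h⟩ := hβ
  have hbase : PoleFreeAtNegOne f fun m => g * f ^ (m + 1) :=
    ⟨0, Polynomial.C g, g, by simp, by simp⟩
  obtain ⟨k, Q, D, hQ, hD⟩ :=
    PoleFreeAtNegOne.sum A fun α => (hbase.map_pdIter α).eval_mul (p α)
  have key : β.map MvPolynomial.C * Polynomial.C (g * f ^ k) = Q * Polynomial.C f := by
    refine polynomial_eq_of_eval_natCast fun m => mul_left_cancel₀ (pow_ne_zero m hf) ?_
    have hm := hQ m
    rw [Finset.sum_apply, ← h m] at hm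
    rw [Polynomial.eval_mul, Polynomial.eval_mul, Polynomial.eval_C, Polynomial.eval_C,
      Polynomial.eval_natCast_map]
    linear_combination hm
  have hev := congrArg (Polynomial.eval (-1)) key
  have hneg : Polynomial.eval (-1) (β.map MvPolynomial.C) =
      (MvPolynomial.C (β.eval (-1)) : MvPolynomial (Fin 2) ℚ) := by
    simpa using Polynomial.eval_intCast_map
      (MvPolynomial.C : ℚ →+* MvPolynomial (Fin 2) ℚ) β (-1)
  rw [Polynomial.eval_mul, Polynomial.eval_mul, Polynomial.eval_C, Polynomial.eval_C, hD,
    hneg] at hev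
  have hdvd : f ∣ MvPolynomial.C (β.eval (-1)) * g :=
    ⟨D, mul_left_cancel₀ (pow_ne_zero k hf) (by linear_combination hev)⟩
  have hroot : β.eval (-1) = 0 := by
    by_contra hne
    refine hfg (((IsUnit.map MvPolynomial.C (Ne.isUnit hne)).dvd_mul_left).mp hdvd)
  rw [← sub_neg_eq_add, ← map_neg, Polynomial.dvd_iff_isRoot]
  exact hroot

theorem not_cusp_dvd_X : ¬ cusp ∣ MvPolynomial.X 1 := by
  rintro ⟨q, hq⟩
  have := congrArg (MvPolynomial.eval ![1, -1]) hq
  norm_num at this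

theorem cusp_ne_zero : cusp ≠ 0 := by
  intro h
  have := congrArg (MvPolynomial.eval ![1, 0]) h
  norm_num at this

theorem bernsteinSato_stmt_7 :
    ∀ b : Polynomial ℚ,
      SatisfiesBS ((X 0) ^ 2 + (X 1) ^ 3 : MvPolynomial (Fin 2) ℚ)
          (X 1) b ↔
        (Polynomial.X + Polynomial.C (1 : ℚ)) *
            (Polynomial.X + Polynomial.C (7 / 6 : ℚ)) *
            (Polynomial.X + Polynomial.C (11 / 6 : ℚ)) ∣ b := by
  intro b
  constructor
  · intro hb
    have hcop : ∀ {u v : ℚ}, u ≠ v →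
        IsCoprime (Polynomial.X + Polynomial.C u) (Polynomial.X + Polynomial.C v) := by
      intro u v huv
      simpa using Polynomial.isCoprime_X_sub_C_of_isUnit_sub
        (show IsUnit (-u - -v) from (sub_ne_zero.mpr (neg_injective.ne huv)).isUnit)
    refine IsCoprime.mul_dvd (.mul_left (hcop (by norm_num)) (hcop (by norm_num)))
      (IsCoprime.mul_dvd (hcop (by norm_num)) ?_ (X_add_seven_sixths_dvd hb))
      (X_add_eleven_sixths_dvd hb)
    exact X_add_one_dvd_of_satisfiesBS cusp_ne_zero not_cusp_dvd_X hb
  · rintro ⟨c, rfl⟩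
    exact bernsteinSato_divisor_satisfies c
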